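/- arXiv:1505.06534 — 3 statements merged into one kernel-verified Lean document; each statement's English description precedes it below -/
import Mathlib

section
/- For every x ∈ ℝ^d and every z ∈ ℂ^d, the multi-indexed series Σ_{k ∈ ℕ^d} P_k(A,ℏ,x) · z^k / k! converges absolutely and equals exp( −⟨ conj(z), A⁻¹ conj(A) z ⟩ + (2/√ℏ) ⟨ conj(z), A⁻¹ x ⟩ ), where z^k = Π_{l=1}^d z_l^{k_l}, k! = Π_{l=1}^d (k_l)!, and conj denotes entrywise complex conjugation. -/
open Matrix Complex

noncomputable section

/-- The pairing `⟨a, b⟩ = ∑ j, conj (a j) * b j` on `ℂ^d`. -/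
def cinner {d : ℕ} (a b : Fin d → ℂ) : ℂ := ∑ j, (starRingEnd ℂ) (a j) * b j

/-- The embedding of `ℝ^d` into `ℂ^d`. -/
def cvec {d : ℕ} (x : Fin d → ℝ) : Fin d → ℂ := fun j => (x j : ℂ)

/-- The `l`-th standard basis vector of `ℂ^d`. -/
def stdC {d : ℕ} (l : Fin d) : Fin d → ℂ := Pi.single l 1

/-- The gradient of `ψ : ℝ^d → ℂ`, viewed as the vector of partial derivatives. -/
def grad {d : ℕ} (ψ : (Fin d → ℝ) → ℂ) (x : Fin d → ℝ) : Fin d → ℂ :=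
  fun j => fderiv ℝ ψ x (Pi.single j 1)

/-- The raising operator `R_l` built from `(A, B)` at semiclassical parameter `h`. -/
def raiseOp {d : ℕ} (A B : Matrix (Fin d) (Fin d) ℂ) (h : ℝ) (l : Fin d)
    (ψ : (Fin d → ℝ) → ℂ) : (Fin d → ℝ) → ℂ := fun x =>
  ((Real.sqrt (2 * h) : ℝ) : ℂ)⁻¹ *
    (cinner (B.mulVec (stdC l)) (cvec x) * ψ x
      - (h : ℂ) * cinner (A.mulVec (stdC l)) (grad ψ x))

/-- The ground state Gaussian `φ₀`, where `sqrtA` is a fixed branch of `√(det A)`. -/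
def phi0 {d : ℕ} (A B : Matrix (Fin d) (Fin d) ℂ) (h : ℝ) (sqrtA : ℂ)
    (x : Fin d → ℝ) : ℂ :=
  ((Real.pi ^ (-(d : ℝ) / 4) * h ^ (-(d : ℝ) / 4) : ℝ) : ℂ) * sqrtA⁻¹ *
    Complex.exp (-(cinner (cvec x) ((B * A⁻¹).mulVec (cvec x)) / ((2 * h : ℝ) : ℂ)))

/-- `R_1^{k_1} ∘ ⋯ ∘ R_d^{k_d}` for a family of operators `R` and a multi-index `k`. -/
def opPow {d : ℕ} {α : Type*} (R : Fin d → (α → α)) (k : Fin d → ℕ) : α → α :=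
  (List.finRange d).foldr (fun l f => (R l)^[k l] ∘ f) id

/-- The polynomials `P_k(A, h, x)`:
`P_k = 2^{|k|/2} (R_1^{k_1} ∘ ⋯ ∘ R_d^{k_d} φ₀)(x) / φ₀(x)`. -/
def Ppoly {d : ℕ} (A B : Matrix (Fin d) (Fin d) ℂ) (h : ℝ) (sqrtA : ℂ)
    (k : Fin d → ℕ) (x : Fin d → ℝ) : ℂ :=
  (((2 : ℝ) ^ (((∑ l, k l : ℕ) : ℝ) / 2) : ℝ) : ℂ) *
    opPow (raiseOp A B h) k (phi0 A B h sqrtA) x / phi0 A B h sqrtA x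

/-- The coordinate partial derivative `∂_j` acting on functions on `ℝ^d`. -/
def pdC {d : ℕ} (j : Fin d) (f : (Fin d → ℝ) → ℂ) : (Fin d → ℝ) → ℂ :=
  fun x => fderiv ℝ f x (Pi.single j 1)

/-- The generating function
`G(x,z) = exp(−⟨conj z, A⁻¹ conj(A) z⟩ + (2/√h) ⟨conj z, A⁻¹ x⟩)`. -/
def Gfun {d : ℕ} (A : Matrix (Fin d) (Fin d) ℂ) (h : ℝ) (x : Fin d → ℝ)
    (z : Fin d → ℂ) : ℂ :=
  Complex.exp
    (-(cinner (fun j => (starRingEnd ℂ) (z j)) ((A⁻¹ * A.map (starRingEnd ℂ)).mulVec z))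
      + (2 / ((Real.sqrt h : ℝ) : ℂ)) *
          cinner (fun j => (starRingEnd ℂ) (z j)) (A⁻¹.mulVec (cvec x)))

/-- The holomorphic partial derivative `∂/∂z_l` of a function on `ℂ^d`. -/
def dz {d : ℕ} (l : Fin d) (f : (Fin d → ℂ) → ℂ) : (Fin d → ℂ) → ℂ :=
  fun z => deriv (fun t => f (Function.update z l t)) (z l)



/-- The `n`-th Taylor coefficient at `0` of the entire function `t ↦ exp (a * t + c * t ^ 2)`. -/
def expQuadCoeff (a c : ℂ) (n : ℕ) : ℂ :=
  (n.factorial : ℂ)⁻¹ * iteratedDeriv n (fun t : ℂ => exp (a * t + c * t ^ 2)) 0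

theorem differentiable_exp_quad (a c : ℂ) :
    Differentiable ℂ (fun t : ℂ => exp (a * t + c * t ^ 2)) := by
  fun_prop

theorem deriv_exp_quad (a c t : ℂ) :
    deriv (fun t : ℂ => exp (a * t + c * t ^ 2)) t
      = (a + 2 * c * t) * exp (a * t + c * t ^ 2) := by
  have h : HasDerivAt (fun t : ℂ => a * t + c * t ^ 2) (a + 2 * c * t) t :=
    (((hasDerivAt_id' t).const_mul a).fun_add ((hasDerivAt_pow 2 t).const_mul c)).congr_deriv
      (by push_cast; ring)
  rw [h.cexp.deriv, mul_comm]

theorem iteratedDeriv_exp_quad (a c : ℂ) (n : ℕ) (t : ℂ) :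
    iteratedDeriv (n + 2) (fun t : ℂ => exp (a * t + c * t ^ 2)) t
      = (a + 2 * c * t) * iteratedDeriv (n + 1) (fun t : ℂ => exp (a * t + c * t ^ 2)) t
        + 2 * c * (n + 1) * iteratedDeriv n (fun t : ℂ => exp (a * t + c * t ^ 2)) t := by
  set f : ℂ → ℂ := fun t => exp (a * t + c * t ^ 2) with hf
  have hd (m : ℕ) : Differentiable ℂ (iteratedDeriv m f) :=
    (ContDiff.differentiable_iteratedDeriv m (n := ⊤) (differentiable_exp_quad a c).contDiff
      (by exact_mod_cast WithTop.coe_lt_top _))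
  have hs (m : ℕ) (t : ℂ) :
      HasDerivAt (iteratedDeriv m f) (iteratedDeriv (m + 1) f t) t := by
    rw [iteratedDeriv_succ]; exact (hd m t).hasDerivAt
  have hl (t : ℂ) : HasDerivAt (fun t : ℂ => a + 2 * c * t) (2 * c) t := by
    simpa using ((hasDerivAt_id t).const_mul (2 * c)).const_add a
  induction n generalizing t with
  | zero =>
    have h1 : iteratedDeriv 1 f = fun t => (a + 2 * c * t) * iteratedDeriv 0 f t := by
      funext s
      rw [iteratedDeriv_one, iteratedDeriv_zero, deriv_exp_quad]
    rw [iteratedDeriv_succ, h1, ((hl t).fun_mul (hs 0 t)).deriv]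
    simp only [h1, iteratedDeriv_zero, zero_add]
    simp
    ring
  | succ n ih =>
    rw [iteratedDeriv_succ, funext ih,
      (((hl t).fun_mul (hs (n + 1) t)).fun_add ((hs n t).const_mul (2 * c * (n + 1)))).deriv]
    simp only [← ih]
    push_cast
    ring

theorem expQuadCoeff_zero (a c : ℂ) : expQuadCoeff a c 0 = 1 := by
  simp [expQuadCoeff]

theorem expQuadCoeff_one (a c : ℂ) : expQuadCoeff a c 1 = a := by
  simp [expQuadCoeff, iteratedDeriv_one, deriv_exp_quad]

theorem expQuadCoeff_add_two (a c : ℂ) (n : ℕ) :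
    ((n + 2 : ℕ) : ℂ) * expQuadCoeff a c (n + 2)
      = a * expQuadCoeff a c (n + 1) + 2 * c * expQuadCoeff a c n := by
  have h1 : (n.factorial : ℂ) ≠ 0 := by exact_mod_cast n.factorial_ne_zero
  have h2 : (n : ℂ) + 1 ≠ 0 := by exact_mod_cast n.succ_ne_zero
  have h3 : (n : ℂ) + 2 ≠ 0 := by exact_mod_cast (n + 1).succ_ne_zero
  have h4 : (n : ℂ) + 1 + 1 ≠ 0 := by convert h3 using 1; ring
  simp only [expQuadCoeff, iteratedDeriv_exp_quad, Nat.factorial_succ]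
  push_cast
  field_simp
  ring

theorem hasSum_expQuadCoeff (a c : ℂ) : HasSum (expQuadCoeff a c) (exp (a + c)) := by
  have h := hasSum_taylorSeries_of_entire (differentiable_exp_quad a c) 0 1
  simp only [sub_zero, one_pow, one_mul, smul_eq_mul] at h
  simpa only [mul_one] using! h

/-- Sum over multi-indices of degree `n` of `w k * z ^ k / k!`. -/
def degreeSum {d : ℕ} {𝕜 : Type*} [Field 𝕜] (z : Fin d → 𝕜) (n : ℕ) (w : (Fin d → ℕ) → 𝕜) : 𝕜 :=
  ∑ k ∈ Finset.univ.piAntidiag n, w k * (∏ l, z l ^ k l) / ((∏ l, (k l).factorial : ℕ) : 𝕜)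

section degreeSum
variable {d : ℕ} {𝕜 : Type*} [Field 𝕜]

theorem prod_pow_add_single (z : Fin d → 𝕜) (k : Fin d → ℕ) (m : Fin d) :
    ∏ l, z l ^ (k + Pi.single m 1 : Fin d → ℕ) l = z m * ∏ l, z l ^ k l := by
  simp_rw [Pi.add_apply, pow_add, Finset.prod_mul_distrib]
  rw [mul_comm]
  congr 1
  rw [Finset.prod_eq_single m] <;> simp +contextual

theorem prod_factorial_add_single (k : Fin d → ℕ) (m : Fin d) :
    ∏ l, ((k + Pi.single m 1 : Fin d → ℕ) l).factorial = (k m + 1) * ∏ l, (k l).factorial := by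
  rw [← Finset.mul_prod_erase _ _ (Finset.mem_univ m),
    ← Finset.mul_prod_erase Finset.univ (fun l => (k l).factorial) (Finset.mem_univ m),
    ← mul_assoc]
  congr 1
  · simp [Nat.factorial_succ]
  · refine Finset.prod_congr rfl fun l hl => ?_
    simp [Finset.ne_of_mem_erase hl]

theorem sum_add_single (k : Fin d → ℕ) (m : Fin d) :
    ∑ l, (k + Pi.single m 1 : Fin d → ℕ) l = ∑ l, k l + 1 := by
  simp [Finset.sum_add_distrib]

theorem sub_single_add_single {k : Fin d → ℕ} {m : Fin d} (h : k m ≠ 0) :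
    k - Pi.single m 1 + Pi.single m 1 = k := by
  funext l
  by_cases hl : l = m
  · subst hl; simp; omega
  · simp [hl]

theorem degreeSum_lower [CharZero 𝕜] (z : Fin d → 𝕜) (n : ℕ) (w : (Fin d → ℕ) → 𝕜) (m : Fin d) :
    degreeSum z (n + 1) (fun k => k m * w (k - Pi.single m 1)) = z m * degreeSum z n w := by
  rw [degreeSum, degreeSum, Finset.mul_sum]
  symm
  refine Finset.sum_of_injOn (fun k => k + Pi.single m 1) (fun a _ b _ h => by simpa using h)
    ?_ ?_ ?_
  · intro k hk
    simp only [Finset.mem_coe, Finset.mem_piAntidiag, Finset.mem_univ, implies_true,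
      and_true] at hk ⊢
    rw [sum_add_single, hk]
  · intro k hk hk'
    have : k m = 0 := by
      by_contra h
      refine hk' ⟨k - Pi.single m 1, ?_, sub_single_add_single h⟩
      have := sum_add_single (k - Pi.single m 1) m
      rw [sub_single_add_single h] at this
      simp only [Finset.mem_coe, Finset.mem_piAntidiag, Finset.mem_univ, implies_true,
        and_true] at hk ⊢
      exact Nat.succ_injective (this.symm.trans hk)
    simp [this]
  · intro k _
    rw [prod_pow_add_single, prod_factorial_add_single, add_tsub_cancel_right]
    have h : (k m : 𝕜) + 1 ≠ 0 := by exact_mod_cast (k m).succ_ne_zero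
    have h' : ((∏ l, (k l).factorial : ℕ) : 𝕜) ≠ 0 := by
      exact_mod_cast Finset.prod_ne_zero_iff.2 fun l _ => (k l).factorial_ne_zero
    simp only [Pi.add_apply, Pi.single_eq_same, Nat.cast_mul, Nat.cast_add, Nat.cast_one]
    field_simp

theorem degreeSum_sum {ι : Type*} (s : Finset ι) (z : Fin d → 𝕜) (n : ℕ)
    (w : ι → (Fin d → ℕ) → 𝕜) :
    degreeSum z n (fun k => ∑ i ∈ s, w i k) = ∑ i ∈ s, degreeSum z n (w i) := by
  simp only [degreeSum, Finset.sum_mul, Finset.sum_div]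
  exact Finset.sum_comm

theorem degreeSum_const_mul (c : 𝕜) (z : Fin d → 𝕜) (n : ℕ) (w : (Fin d → ℕ) → 𝕜) :
    degreeSum z n (fun k => c * w k) = c * degreeSum z n w := by
  simp only [degreeSum, Finset.mul_sum, mul_div_assoc, mul_assoc]

theorem degreeSum_add (z : Fin d → 𝕜) (n : ℕ) (v w : (Fin d → ℕ) → 𝕜) :
    degreeSum z n (fun k => v k + w k) = degreeSum z n v + degreeSum z n w := by
  simp only [degreeSum, ← Finset.sum_add_distrib, add_mul, add_div]

theorem degreeSum_zero (z : Fin d → 𝕜) (w : (Fin d → ℕ) → 𝕜) : degreeSum z 0 w = w 0 := by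
  simp [degreeSum]

theorem degreeSum_congr {z : Fin d → 𝕜} {n : ℕ} {v w : (Fin d → ℕ) → 𝕜}
    (h : ∀ k, ∑ l, k l = n → v k = w k) : degreeSum z n v = degreeSum z n w :=
  Finset.sum_congr rfl fun k hk => by rw [h k (Finset.mem_piAntidiag.1 hk).1]

theorem degreeSum_succ [CharZero 𝕜] (z : Fin d → 𝕜) (n : ℕ) (w : (Fin d → ℕ) → 𝕜) :
    ((n + 1 : ℕ) : 𝕜) * degreeSum z (n + 1) w
      = ∑ l, z l * degreeSum z n (fun k => w (k + Pi.single l 1)) := by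
  simp_rw [← degreeSum_lower, ← degreeSum_sum, ← degreeSum_const_mul]
  refine degreeSum_congr fun k hk => ?_
  rw [← hk, Nat.cast_sum, Finset.sum_mul]
  refine Finset.sum_congr rfl fun l _ => ?_
  by_cases h : k l = 0
  · simp [h]
  · rw [sub_single_add_single h]

/-- The right-hand side of the recurrence `w (k + e_l) = a l * w k + 2 * ∑ m, S l m * k m * w (k - e_m)`
satisfied by the coefficients of `exp (∑ l, z l * a l + ∑ l, ∑ m, z l * S l m * z m)`. -/
def recurrenceRHS (a : Fin d → 𝕜) (S : Matrix (Fin d) (Fin d) 𝕜) (w : (Fin d → ℕ) → 𝕜) (l : Fin d)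
    (k : Fin d → ℕ) : 𝕜 :=
  a l * w k + 2 * ∑ m, S l m * (k m * w (k - Pi.single m 1))

theorem sum_degreeSum_zero_recurrenceRHS (a : Fin d → 𝕜) (S : Matrix (Fin d) (Fin d) 𝕜)
    (z : Fin d → 𝕜) (w : (Fin d → ℕ) → 𝕜) :
    ∑ l, z l * degreeSum z 0 (recurrenceRHS a S w l) = (∑ l, z l * a l) * w 0 := by
  simp [degreeSum_zero, recurrenceRHS, Finset.sum_mul, mul_assoc]

theorem sum_degreeSum_succ_recurrenceRHS [CharZero 𝕜] (a : Fin d → 𝕜)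
    (S : Matrix (Fin d) (Fin d) 𝕜) (z : Fin d → 𝕜) (w : (Fin d → ℕ) → 𝕜) (n : ℕ) :
    ∑ l, z l * degreeSum z (n + 1) (recurrenceRHS a S w l)
      = (∑ l, z l * a l) * degreeSum z (n + 1) w
        + 2 * (∑ l, ∑ m, z l * S l m * z m) * degreeSum z n w := by
  have h (l : Fin d) : degreeSum z (n + 1) (recurrenceRHS a S w l)
      = a l * degreeSum z (n + 1) w + 2 * ∑ m, S l m * (z m * degreeSum z n w) := by
    unfold recurrenceRHS
    rw [degreeSum_add, degreeSum_const_mul, degreeSum_const_mul, degreeSum_sum]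
    simp_rw [← degreeSum_lower, ← degreeSum_const_mul]
  simp only [h, mul_add, Finset.sum_add_distrib, Finset.sum_mul, Finset.mul_sum]
  congr 1
  · exact Finset.sum_congr rfl fun l _ => by ring
  · exact Finset.sum_congr rfl fun l _ => Finset.sum_congr rfl fun m _ => by ring

theorem sum_mul_degreeSum_mono {z : Fin d → ℝ} (hz : ∀ l, 0 ≤ z l) (n : ℕ)
    {v w : Fin d → (Fin d → ℕ) → ℝ} (h : ∀ l k, v l k ≤ w l k) :
    ∑ l, z l * degreeSum z n (v l) ≤ ∑ l, z l * degreeSum z n (w l) := by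
  refine Finset.sum_le_sum fun l _ => mul_le_mul_of_nonneg_left ?_ (hz l)
  refine Finset.sum_le_sum fun k _ => ?_
  have hp : 0 ≤ ∏ l, z l ^ k l := Finset.prod_nonneg fun l _ => pow_nonneg (hz l) _
  gcongr
  exact h l k

theorem norm_recurrenceRHS_le (a : Fin d → ℂ) (S : Matrix (Fin d) (Fin d) ℂ)
    (w : (Fin d → ℕ) → ℂ) (l : Fin d) (k : Fin d → ℕ) :
    ‖recurrenceRHS a S w l k‖
      ≤ recurrenceRHS (fun l => ‖a l‖) (S.map fun s => ‖s‖) (fun k => ‖w k‖) l k := by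
  refine (norm_add_le _ _).trans (add_le_add (norm_mul_le _ _) ?_)
  rw [norm_mul, Complex.norm_two]
  gcongr
  refine (norm_sum_le _ _).trans (Finset.sum_le_sum fun m _ => ?_)
  rw [norm_mul, norm_mul, Complex.norm_natCast, Matrix.map_apply]

end degreeSum

/-- Partial sums by degree exhaust the multi-indices. -/
theorem tendsto_biUnion_piAntidiag (d : ℕ) :
    Filter.Tendsto (fun N : ℕ => (Finset.range N).biUnion
      fun n => (Finset.univ : Finset (Fin d)).piAntidiag n) Filter.atTop Filter.atTop := by
  refine Filter.tendsto_atTop_finset_of_monotone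
    (fun M N h => Finset.biUnion_subset_biUnion_of_subset_left _ (Finset.range_mono h)) fun k => ?_
  exact ⟨∑ l, k l + 1, by simp⟩

theorem sum_biUnion_piAntidiag {d : ℕ} {M : Type*} [AddCommMonoid M] (N : ℕ)
    (f : (Fin d → ℕ) → M) :
    ∑ k ∈ (Finset.range N).biUnion fun n => (Finset.univ : Finset (Fin d)).piAntidiag n, f k
      = ∑ n ∈ Finset.range N, ∑ k ∈ Finset.univ.piAntidiag n, f k := by
  refine Finset.sum_biUnion fun m _ n _ hmn => Finset.disjoint_left.2 fun k hm hn => hmn ?_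
  simp only [Finset.mem_piAntidiag] at hm hn
  rw [← hm.1, ← hn.1]

theorem degreeSum_norm_le {d : ℕ} {a : Fin d → ℂ} {S : Matrix (Fin d) (Fin d) ℂ}
    (z : Fin d → ℂ) {w : (Fin d → ℕ) → ℂ} (h0 : w 0 = 1)
    (hw : ∀ k l, w (k + Pi.single l 1) = recurrenceRHS a S w l k) (n : ℕ) :
    degreeSum (fun l => ‖z l‖) n (fun k => ‖w k‖)
      ≤ (expQuadCoeff ((∑ l, ‖z l‖ * ‖a l‖ : ℝ) : ℂ)
          ((∑ l, ∑ m, ‖z l‖ * ‖S l m‖ * ‖z m‖ : ℝ) : ℂ) n).re := by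
  have hstep (n : ℕ) := (degreeSum_succ (fun l => ‖z l‖) n (fun k => ‖w k‖)).trans_le
    (sum_mul_degreeSum_mono (fun l => norm_nonneg (z l)) n
      fun l k => (hw k l ▸ norm_recurrenceRHS_le a S w l k))
  set b : ℝ := ∑ l, ‖z l‖ * ‖a l‖
  set c : ℝ := ∑ l, ∑ m, ‖z l‖ * ‖S l m‖ * ‖z m‖
  have hb : 0 ≤ b := by positivity
  have hc : 0 ≤ c := by positivity
  induction n using Nat.twoStepInduction with
  | zero => simp [degreeSum_zero, h0, expQuadCoeff_zero]
  | one =>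
    have h := hstep 0
    rw [sum_degreeSum_zero_recurrenceRHS] at h
    simpa [h0, expQuadCoeff_one] using h
  | more n ih1 ih2 =>
    have h := hstep (n + 1)
    rw [sum_degreeSum_succ_recurrenceRHS] at h
    have hre : ((n + 2 : ℕ) : ℝ) * (expQuadCoeff b c (n + 2)).re
        = b * (expQuadCoeff b c (n + 1)).re + 2 * c * (expQuadCoeff b c n).re := by
      have := congrArg Complex.re (expQuadCoeff_add_two b c n)
      rw [← Complex.ofReal_natCast, Complex.re_ofReal_mul, Complex.add_re, Complex.re_ofReal_mul,
        ← Complex.ofReal_ofNat, ← Complex.ofReal_mul, Complex.re_ofReal_mul] at this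
      exact this
    have hn : (0 : ℝ) < ((n + 2 : ℕ) : ℝ) := by positivity
    refine le_of_mul_le_mul_left (h.trans ?_) hn
    rw [hre]
    exact add_le_add (mul_le_mul_of_nonneg_left ih2 hb)
      (mul_le_mul_of_nonneg_left ih1 (by positivity))

theorem norm_summable_and_hasSum_of_recurrence {d : ℕ} (a : Fin d → ℂ)
    (S : Matrix (Fin d) (Fin d) ℂ) (z : Fin d → ℂ) (w : (Fin d → ℕ) → ℂ) (h0 : w 0 = 1)
    (hw : ∀ k l, w (k + Pi.single l 1)
      = recurrenceRHS a S w l k) :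
    Summable (fun k : Fin d → ℕ =>
      ‖w k * (∏ l, z l ^ k l) / ((∏ l, (k l).factorial : ℕ) : ℂ)‖) ∧
    HasSum (fun k : Fin d → ℕ => w k * (∏ l, z l ^ k l) / ((∏ l, (k l).factorial : ℕ) : ℂ))
      (exp (∑ l, z l * a l + ∑ l, ∑ m, z l * S l m * z m)) := by
  set F : (Fin d → ℕ) → ℂ := fun k => w k * (∏ l, z l ^ k l) / ((∏ l, (k l).factorial : ℕ) : ℂ)
  have hF : Summable fun k => ‖F k‖ := by
    have hs := Complex.hasSum_re (hasSum_expQuadCoeff ((∑ l, ‖z l‖ * ‖a l‖ : ℝ) : ℂ)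
      ((∑ l, ∑ m, ‖z l‖ * ‖S l m‖ * ‖z m‖ : ℝ) : ℂ))
    have hle := degreeSum_norm_le z h0 hw
    have hpos (n : ℕ) : 0 ≤ degreeSum (fun l => ‖z l‖) n (fun k => ‖w k‖) :=
      Finset.sum_nonneg fun k _ => by positivity
    refine summable_of_sum_le (c := (exp (((∑ l, ‖z l‖ * ‖a l‖ : ℝ) : ℂ)
      + ((∑ l, ∑ m, ‖z l‖ * ‖S l m‖ * ‖z m‖ : ℝ) : ℂ))).re)
      (fun k => norm_nonneg _) fun s => ?_
    obtain ⟨N, hN⟩ := ((tendsto_biUnion_piAntidiag d).eventually_ge_atTop s).exists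
    refine (Finset.sum_le_sum_of_subset_of_nonneg hN fun k _ _ => norm_nonneg _).trans ?_
    rw [sum_biUnion_piAntidiag]
    refine le_trans (Finset.sum_le_sum fun n _ => ?_)
      (sum_le_hasSum (Finset.range N) (fun n _ => (hpos n).trans (hle n)) hs)
    refine le_of_eq_of_le (Finset.sum_congr rfl fun k _ => ?_) (hle n)
    simp only [F, norm_div, norm_mul, norm_prod, norm_pow, Complex.norm_natCast]
  refine ⟨hF, ?_⟩
  have hd : ∀ n, degreeSum z n w
      = expQuadCoeff (∑ l, z l * a l) (∑ l, ∑ m, z l * S l m * z m) n := by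
    intro n
    induction n using Nat.twoStepInduction with
    | zero => rw [degreeSum_zero, h0, expQuadCoeff_zero]
    | one =>
      have h := degreeSum_succ z 0 w
      simp only [hw] at h
      rw [sum_degreeSum_zero_recurrenceRHS] at h
      simpa [h0, expQuadCoeff_one] using h
    | more n ih1 ih2 =>
      have hn : ((n + 2 : ℕ) : ℂ) ≠ 0 := by exact_mod_cast (n + 1).succ_ne_zero
      apply mul_left_cancel₀ hn
      have h := degreeSum_succ z (n + 1) w
      simp only [hw] at h
      rw [sum_degreeSum_succ_recurrenceRHS] at h
      rw [h, expQuadCoeff_add_two, ih1, ih2]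
  have h1 := hF.of_norm.hasSum
  have h2 := h1.comp (tendsto_biUnion_piAntidiag d)
  have h3 := (hasSum_expQuadCoeff (∑ l, z l * a l)
    (∑ l, ∑ m, z l * S l m * z m)).tendsto_sum_nat
  rw [← tendsto_nhds_unique h2 (h3.congr fun N => ?_)]
  · exact h1
  · simp only [Function.comp_apply, sum_biUnion_piAntidiag, ← hd]
    rfl

section opPow
variable {d : ℕ} {α β : Type*}

theorem opPow_zero (T : Fin d → α → α) : opPow T 0 = id := by
  unfold opPow
  induction List.finRange d with
  | nil => rfl
  | cons m L ih => rw [List.foldr_cons, ih]; rfl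

theorem opPow_semiconj {Φ : β → α} {R : Fin d → α → α} {T : Fin d → β → β}
    (h : ∀ l, Function.Semiconj Φ (T l) (R l)) (k : Fin d → ℕ) :
    Function.Semiconj Φ (opPow T k) (opPow R k) := by
  unfold opPow
  induction List.finRange d with
  | nil => exact Function.Semiconj.id_right
  | cons m L ih => exact ((h m).iterate_right (k m)).comp_right ih

theorem opPow_add_single {T : Fin d → α → α} (hT : ∀ l m, Function.Commute (T l) (T m))
    (k : Fin d → ℕ) (l : Fin d) : opPow T (k + Pi.single l 1) = T l ∘ opPow T k := by
  have hnot : ∀ L : List (Fin d), l ∉ L →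
      L.foldr (fun m f => (T m)^[(k + Pi.single l 1 : Fin d → ℕ) m] ∘ f) id
        = L.foldr (fun m f => (T m)^[k m] ∘ f) id := by
    intro L hL
    induction L with
    | nil => rfl
    | cons m L ih =>
      rw [List.mem_cons, not_or] at hL
      rw [List.foldr_cons, List.foldr_cons, ih hL.2]
      simp [Ne.symm hL.1]
  have hmem : ∀ L : List (Fin d), L.Nodup → l ∈ L →
      L.foldr (fun m f => (T m)^[(k + Pi.single l 1 : Fin d → ℕ) m] ∘ f) id
        = T l ∘ L.foldr (fun m f => (T m)^[k m] ∘ f) id := by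
    intro L hL hl
    induction L with
    | nil => simp at hl
    | cons m L ih =>
      rw [List.nodup_cons] at hL
      by_cases hml : m = l
      · subst hml
        rw [List.foldr_cons, List.foldr_cons, hnot L hL.1, ← Function.comp_assoc,
          ← Function.iterate_succ']
        simp
      · have hl' : l ∈ L := (List.mem_cons.1 hl).resolve_left (Ne.symm hml)
        rw [List.foldr_cons, List.foldr_cons, ih hL.2 hl', ← Function.comp_assoc,
          ← Function.comp_assoc]
        simp only [Pi.add_apply, Pi.single_eq_of_ne hml, add_zero]
        rw [((hT m l).iterate_left (k m)).comp_eq]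
  exact hmem _ (List.nodup_finRange d) (List.mem_finRange l)

end opPow

section raising
variable {d : ℕ} {E : Type*} [CommRing E] [Algebra ℂ E] {D : Fin d → Derivation ℂ E E}
  {a : Fin d → E} {σ : Matrix (Fin d) (Fin d) ℂ}

/-- Multiplication by `a l` minus the derivation `D l`. -/
def derivRaise (D : Fin d → Derivation ℂ E E) (a : Fin d → E) (l : Fin d) (p : E) : E :=
  a l * p - D l p

theorem derivRaise_commute (hD : ∀ l m p, D l (D m p) = D m (D l p))
    (ha : ∀ l m, D l (a m) = algebraMap ℂ E (σ l m)) (hσ : ∀ l m, σ l m = σ m l) (l m : Fin d) :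
    Function.Commute (derivRaise D a l) (derivRaise D a m) := by
  intro p
  simp only [derivRaise, map_sub, Derivation.leibniz, ha, smul_eq_mul, hD l m p, hσ l m]
  ring

theorem derivation_opPow_derivRaise_one (hD : ∀ l m p, D l (D m p) = D m (D l p))
    (ha : ∀ l m, D l (a m) = algebraMap ℂ E (σ l m)) (hσ : ∀ l m, σ l m = σ m l)
    (k : Fin d → ℕ) (l : Fin d) :
    D l (opPow (derivRaise D a) k 1)
      = ∑ m, σ l m • (k m : ℂ) • opPow (derivRaise D a) (k - Pi.single m 1) 1 := by
  have hadd (k : Fin d → ℕ) (l : Fin d) : opPow (derivRaise D a) (k + Pi.single l 1) 1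
      = derivRaise D a l (opPow (derivRaise D a) k 1) :=
    congrFun (opPow_add_single (derivRaise_commute hD ha hσ) k l) 1
  induction hn : ∑ i, k i generalizing k l with
  | zero =>
    have hk : k = 0 := by
      funext i
      simpa using (Finset.sum_eq_zero_iff.1 hn) i (Finset.mem_univ i)
    simp [hk, opPow_zero]
  | succ n ih =>
    obtain ⟨j, hj⟩ : ∃ j, k j ≠ 0 := by
      by_contra! h
      simp [h] at hn
    obtain ⟨k, rfl⟩ : ∃ k' : Fin d → ℕ, k = k' + Pi.single j 1 :=
      ⟨_, (sub_single_add_single hj).symm⟩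
    have hk : ∑ i, k i = n := by
      rw [sum_add_single] at hn; omega
    have hlin (p : E) : D l (derivRaise D a j p) = σ l j • p + derivRaise D a j (D l p) := by
      simp only [derivRaise, map_sub, Derivation.leibniz, ha, smul_eq_mul, hD l j p,
        Algebra.smul_def]
      ring
    have hsum : derivRaise D a j
          (∑ m, σ l m • (k m : ℂ) • opPow (derivRaise D a) (k - Pi.single m 1) 1)
        = ∑ m, σ l m • (k m : ℂ) • opPow (derivRaise D a) (k + Pi.single j 1 - Pi.single m 1) 1 := by
      simp only [derivRaise, map_sum, Finset.mul_sum, ← Finset.sum_sub_distrib]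
      refine Finset.sum_congr rfl fun m _ => ?_
      by_cases hm : k m = 0
      · simp [hm]
      · have : k + Pi.single j 1 - Pi.single m 1 = k - Pi.single m 1 + Pi.single j 1 := by
          nth_rw 1 [← sub_single_add_single hm]
          rw [add_right_comm, add_tsub_cancel_right]
        rw [this, hadd]
        simp only [derivRaise, Derivation.map_smul, mul_smul_comm, smul_sub]
    rw [hadd, hlin, ih k l hk, hsum]
    simp only [Pi.add_apply, Nat.cast_add, add_smul, smul_add, Finset.sum_add_distrib]
    rw [add_comm]
    congr 1
    rw [Finset.sum_eq_single j]
    · simp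
    · intro m _ hm
      simp [hm]
    · simp

theorem opPow_derivRaise_one_add_single (hD : ∀ l m p, D l (D m p) = D m (D l p))
    (ha : ∀ l m, D l (a m) = algebraMap ℂ E (σ l m)) (hσ : ∀ l m, σ l m = σ m l)
    (k : Fin d → ℕ) (l : Fin d) :
    opPow (derivRaise D a) (k + Pi.single l 1) 1
      = a l * opPow (derivRaise D a) k 1
        - ∑ m, σ l m • (k m : ℂ) • opPow (derivRaise D a) (k - Pi.single m 1) 1 := by
  rw [opPow_add_single (derivRaise_commute hD ha hσ), Function.comp_apply,
    ← derivation_opPow_derivRaise_one hD ha hσ]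
  rfl

end raising

section matrices
variable {n : Type*} [Fintype n] [DecidableEq n] {A B : Matrix n n ℂ}

theorem isSymm_mul_inv (hA : IsUnit A.det) (h : Aᵀ * B - Bᵀ * A = 0) : (B * A⁻¹).IsSymm := by
  have hA' : IsUnit Aᵀ.det := by rwa [det_transpose]
  rw [IsSymm, transpose_mul, transpose_nonsing_inv]
  calc Aᵀ⁻¹ * Bᵀ = Aᵀ⁻¹ * (Bᵀ * A) * A⁻¹ := by
        rw [Matrix.mul_assoc, mul_nonsing_inv_cancel_right A Bᵀ hA]
    _ = B * A⁻¹ := by rw [← sub_eq_zero.1 h, nonsing_inv_mul_cancel_left Aᵀ B hA']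

theorem mul_conjTranspose_eq_conj_mul_transpose
    (h₁ : Aᴴ * B + Bᴴ * A = (2 : ℂ) • (1 : Matrix n n ℂ)) (h₂ : Aᵀ * B - Bᵀ * A = 0) :
    A * Aᴴ = A.map (starRingEnd ℂ) * Aᵀ := by
  have hc (M N : Matrix n n ℂ) :
      (M * N).map (starRingEnd ℂ) = M.map (starRingEnd ℂ) * N.map (starRingEnd ℂ) :=
    Matrix.map_mul
  have e (M : Matrix n n ℂ) : Mᴴ.map (starRingEnd ℂ) = Mᵀ := by ext; simp
  have e' (M : Matrix n n ℂ) : Mᵀ.map (starRingEnd ℂ) = Mᴴ := rfl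
  have h₁' := congrArg (fun M => M.map (starRingEnd ℂ)) h₁
  have h₂' := congrArg (fun M => M.map (starRingEnd ℂ)) (sub_eq_zero.1 h₂)
  simp only [hc, e', Matrix.map_add _ (map_add (starRingEnd ℂ)), e] at h₁' h₂'
  have h₃ : ((2 : ℂ) • (1 : Matrix n n ℂ)).map (starRingEnd ℂ) = (2 : ℂ) • 1 := by
    ext i j; by_cases hij : i = j <;> simp [hij, Complex.conj_ofNat]
  rw [h₃] at h₁'
  have hLF : ((1 / 2 : ℂ) • fromBlocks Bᴴ Aᴴ Bᵀ (-Aᵀ)) *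
      fromBlocks A (A.map (starRingEnd ℂ)) B (-B.map (starRingEnd ℂ)) = 1 := by
    rw [smul_mul_assoc, fromBlocks_multiply]
    simp only [Matrix.neg_mul, Matrix.mul_neg, neg_neg]
    rw [add_comm (Bᴴ * A), h₁, ← sub_eq_add_neg, ← sub_eq_add_neg, h₂', sub_self,
      sub_eq_zero.1 h₂, sub_self, add_comm (Bᵀ * _), h₁', fromBlocks_smul, smul_smul]
    simp
  have hFL := mul_eq_one_comm.1 hLF
  rw [mul_smul_comm, fromBlocks_multiply, fromBlocks_smul, ← fromBlocks_one, fromBlocks_inj] at hFL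
  have h := hFL.2.1
  rw [smul_eq_zero_iff_right (by norm_num), Matrix.mul_neg, ← sub_eq_add_neg] at h
  exact sub_eq_zero.1 h

theorem isSymm_inv_mul_conj (hA : IsUnit A.det)
    (h₁ : Aᴴ * B + Bᴴ * A = (2 : ℂ) • (1 : Matrix n n ℂ)) (h₂ : Aᵀ * B - Bᵀ * A = 0) :
    (A⁻¹ * A.map (starRingEnd ℂ)).IsSymm := by
  have hA' : IsUnit Aᵀ.det := by rwa [det_transpose]
  rw [IsSymm, transpose_mul, transpose_nonsing_inv]
  calc Aᴴ * Aᵀ⁻¹ = A⁻¹ * (A * Aᴴ) * Aᵀ⁻¹ := by rw [nonsing_inv_mul_cancel_left A _ hA]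
    _ = A⁻¹ * A.map (starRingEnd ℂ) := by
      rw [mul_conjTranspose_eq_conj_mul_transpose h₁ h₂, ← Matrix.mul_assoc,
        mul_nonsing_inv_cancel_right Aᵀ _ hA']

theorem conjTranspose_add_mul_inv (hA : IsUnit A.det)
    (h₁ : Aᴴ * B + Bᴴ * A = (2 : ℂ) • (1 : Matrix n n ℂ)) :
    Bᴴ + Aᴴ * (B * A⁻¹) = (2 : ℂ) • A⁻¹ := by
  rw [← Matrix.mul_assoc, ← mul_nonsing_inv_cancel_right A Bᴴ hA, ← Matrix.add_mul, add_comm, h₁,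
    smul_mul_assoc, Matrix.one_mul]

end matrices

section polynomials
open MvPolynomial
variable {d : ℕ}

theorem differentiable_cvec (i : Fin d) : Differentiable ℝ fun y : Fin d → ℝ => cvec y i :=
  (ofRealCLM.comp (ContinuousLinearMap.proj i : (Fin d → ℝ) →L[ℝ] ℝ)).differentiable

theorem grad_cvec (i : Fin d) (x : Fin d → ℝ) (j : Fin d) :
    grad (fun y => cvec y i) x j = if i = j then 1 else 0 := by
  have h : HasFDerivAt (fun y : Fin d → ℝ => cvec y i)
      (ofRealCLM.comp (ContinuousLinearMap.proj i : (Fin d → ℝ) →L[ℝ] ℝ)) x :=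
    (ofRealCLM.comp (ContinuousLinearMap.proj i : (Fin d → ℝ) →L[ℝ] ℝ)).hasFDerivAt
  rw [grad, h.fderiv]
  simp [Pi.single_apply, apply_ite ofReal]

theorem grad_mul {f g : (Fin d → ℝ) → ℂ} {x : Fin d → ℝ} (hf : DifferentiableAt ℝ f x)
    (hg : DifferentiableAt ℝ g x) (j : Fin d) :
    grad (fun y => f y * g y) x j = f x * grad g x j + g x * grad f x j := by
  simp [grad, fderiv_fun_mul hf hg]

theorem differentiable_eval_cvec (p : MvPolynomial (Fin d) ℂ) :
    Differentiable ℝ fun y => eval (cvec y) p := by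
  induction p using MvPolynomial.induction_on with
  | C c => simp
  | add p q hp hq => simpa using hp.fun_add hq
  | mul_X p i hp => simpa using hp.fun_mul (differentiable_cvec i)

theorem grad_eval (p : MvPolynomial (Fin d) ℂ) (x : Fin d → ℝ) (j : Fin d) :
    grad (fun y => eval (cvec y) p) x j = eval (cvec x) (pderiv j p) := by
  induction p using MvPolynomial.induction_on with
  | C c => simp [grad]
  | add p q hp hq =>
    simp only [grad, map_add] at hp hq ⊢
    rw [fderiv_fun_add (differentiable_eval_cvec p x) (differentiable_eval_cvec q x)]
    simp [hp, hq]
  | mul_X p i hp =>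
    simp only [map_mul, eval_X]
    rw [grad_mul (differentiable_eval_cvec p x) (differentiable_cvec i x), hp, grad_cvec]
    simp only [pderiv_mul, map_add, map_mul, eval_X, pderiv_X, Pi.single_apply]
    split_ifs <;> simp <;> ring

theorem grad_eval_mul_exp_eval (p q : MvPolynomial (Fin d) ℂ) (c : ℂ) (x : Fin d → ℝ) (j : Fin d) :
    grad (fun y => eval (cvec y) p * (c * exp (eval (cvec y) q))) x j
      = eval (cvec x) (pderiv j p + p * pderiv j q) * (c * exp (eval (cvec x) q)) := by
  have hq := ((differentiable_eval_cvec q x).hasFDerivAt.cexp).const_mul c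
  have hq' : grad (fun y => c * exp (eval (cvec y) q)) x j
      = c * (exp (eval (cvec x) q) * grad (fun y => eval (cvec y) q) x j) := by
    rw [grad, hq.fderiv]
    rfl
  rw [grad_mul (differentiable_eval_cvec p x) hq.differentiableAt, hq', grad_eval, grad_eval,
    map_add, map_mul]
  ring

end polynomials

section hagedorn
open MvPolynomial
variable {d : ℕ}

/-- The linear form with coefficient vector `u`. -/
def linForm (u : Fin d → ℂ) : MvPolynomial (Fin d) ℂ := ∑ j, C (u j) * X j

/-- The quadratic form with coefficient matrix `M`. -/
def quadForm (M : Matrix (Fin d) (Fin d) ℂ) : MvPolynomial (Fin d) ℂ :=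
  ∑ i, ∑ j, C (M i j) * (X i * X j)

/-- The derivative in the constant direction `v`. -/
def dirDeriv (v : Fin d → ℂ) : Derivation ℂ (MvPolynomial (Fin d) ℂ) (MvPolynomial (Fin d) ℂ) :=
  ∑ j, v j • pderiv j

theorem eval_linForm (u y : Fin d → ℂ) : eval y (linForm u) = u ⬝ᵥ y := by
  simp [linForm, dotProduct]

theorem dirDeriv_apply (v : Fin d → ℂ) (p : MvPolynomial (Fin d) ℂ) :
    dirDeriv v p = ∑ j, v j • pderiv j p := by
  rw [dirDeriv, ← Derivation.coeFnAddMonoidHom_apply, map_sum, Finset.sum_apply]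
  rfl

theorem dirDeriv_linForm (v u : Fin d → ℂ) : dirDeriv v (linForm u) = C (u ⬝ᵥ v) := by
  simp [dirDeriv_apply, linForm, dotProduct, pderiv_X, Pi.single_apply, smul_eq_C_mul, mul_comm]

theorem dirDeriv_comm (v w : Fin d → ℂ) (p : MvPolynomial (Fin d) ℂ) :
    dirDeriv v (dirDeriv w p) = dirDeriv w (dirDeriv v p) := by
  have h (i j : Fin d) : pderiv i (pderiv j p) = pderiv j (pderiv i p) := by
    induction p using MvPolynomial.induction_on with
    | C c => simp
    | add p q hp hq => simp [hp, hq]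
    | mul_X p k hp =>
      simp only [pderiv_mul, map_add, hp, pderiv_X, Pi.single_apply]
      (split_ifs <;> simp); ring
  simp only [dirDeriv_apply, map_sum, Finset.smul_sum, Derivation.map_smul]
  rw [Finset.sum_comm]
  refine Finset.sum_congr rfl fun i _ => Finset.sum_congr rfl fun j _ => ?_
  rw [h, smul_comm]

theorem eval_quadForm (M : Matrix (Fin d) (Fin d) ℂ) (y : Fin d → ℂ) :
    eval y (quadForm M) = y ⬝ᵥ M *ᵥ y := by
  simp only [quadForm, map_sum, map_mul, eval_C, eval_X, dotProduct, mulVec, Finset.mul_sum]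
  exact Finset.sum_congr rfl fun i _ => Finset.sum_congr rfl fun j _ => by ring

theorem eval_pderiv_quadForm {M : Matrix (Fin d) (Fin d) ℂ} (hM : M.IsSymm) (y : Fin d → ℂ)
    (l : Fin d) : eval y (pderiv l (quadForm M)) = 2 * (M *ᵥ y) l := by
  have h : eval y (pderiv l (quadForm M)) = ∑ j, M l j * y j + ∑ i, M i l * y i := by
    simp only [quadForm, map_sum, pderiv_mul, pderiv_X, map_add, map_mul,
      eval_X, eval_C, mul_add, Finset.sum_add_distrib, Pi.single_apply, apply_ite (eval y),
      map_zero, ite_mul, mul_ite, one_mul, zero_mul, mul_one, mul_zero]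
    simp
  rw [h, two_mul]
  congr 1
  exact Finset.sum_congr rfl fun i _ => by rw [hM.apply]

variable {A B : Matrix (Fin d) (Fin d) ℂ} {h : ℝ}

/-- The polynomial by which `R_l` multiplies after conjugation with the Gaussian. -/
def raiseMul (A : Matrix (Fin d) (Fin d) ℂ) (h : ℝ) (l : Fin d) : MvPolynomial (Fin d) ℂ :=
  linForm ((2 * ((√(2 * h) : ℝ) : ℂ)⁻¹) • A⁻¹ l)

/-- The directional derivative occurring in `R_l`. -/
def raiseDeriv (A : Matrix (Fin d) (Fin d) ℂ) (h : ℝ) (l : Fin d) :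
    Derivation ℂ (MvPolynomial (Fin d) ℂ) (MvPolynomial (Fin d) ℂ) :=
  dirDeriv ((((√(2 * h) : ℝ) : ℂ)⁻¹ * h) • fun j => (starRingEnd ℂ) (A j l))

theorem ofReal_sqrt_sq {t : ℝ} (ht : 0 ≤ t) : ((√t : ℝ) : ℂ) ^ 2 = t := by
  rw [← ofReal_pow, Real.sq_sqrt ht]

theorem raiseDeriv_raiseMul (hh : 0 < h) (hS : (A⁻¹ * A.map (starRingEnd ℂ)).IsSymm)
    (l m : Fin d) : raiseDeriv A h l (raiseMul A h m)
      = algebraMap ℂ _ ((A⁻¹ * A.map (starRingEnd ℂ)) l m) := by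
  have hr := ofReal_sqrt_sq (show 0 ≤ 2 * h by positivity)
  have hh' : (h : ℂ) ≠ 0 := by exact_mod_cast hh.ne'
  rw [raiseDeriv, raiseMul, dirDeriv_linForm, algebraMap_eq, ← hS.apply, smul_dotProduct,
    dotProduct_smul, smul_smul]
  have hc : 2 * ((√(2 * h) : ℝ) : ℂ)⁻¹ * (((√(2 * h) : ℝ) : ℂ)⁻¹ * h) = 1 := by
    rw [show 2 * ((√(2 * h) : ℝ) : ℂ)⁻¹ * (((√(2 * h) : ℝ) : ℂ)⁻¹ * h)
      = 2 * h * (((√(2 * h) : ℝ) : ℂ) ^ 2)⁻¹ by ring, hr]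
    push_cast
    field_simp
  rw [hc, one_smul]
  rfl

theorem phi0_eq (A B : Matrix (Fin d) (Fin d) ℂ) (h : ℝ) (s : ℂ) (x : Fin d → ℝ) :
    phi0 A B h s x = ((Real.pi ^ (-(d : ℝ) / 4) * h ^ (-(d : ℝ) / 4) : ℝ) : ℂ) * s⁻¹ *
      exp (eval (cvec x) (C (-((2 * h : ℝ) : ℂ)⁻¹) * quadForm (B * A⁻¹))) := by
  rw [phi0, map_mul, eval_C, eval_quadForm]
  congr 2
  simp only [cinner, cvec, conj_ofReal, dotProduct]
  ring

theorem mulVec_stdC (M : Matrix (Fin d) (Fin d) ℂ) (l j : Fin d) : (M *ᵥ stdC l) j = M j l := by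
  simp [stdC]

theorem raiseOp_eval_mul_phi0 (hh : 0 < h) (hA : IsUnit A.det)
    (h₁ : Aᴴ * B + Bᴴ * A = (2 : ℂ) • (1 : Matrix (Fin d) (Fin d) ℂ)) (h₂ : Aᵀ * B - Bᵀ * A = 0)
    (s : ℂ) (l : Fin d) (p : MvPolynomial (Fin d) ℂ) :
    raiseOp A B h l (fun x => eval (cvec x) p * phi0 A B h s x)
      = fun x => eval (cvec x) (derivRaise (raiseDeriv A h) (raiseMul A h) l p)
          * phi0 A B h s x := by
  funext x
  have hh' : (h : ℂ) ≠ 0 := by exact_mod_cast hh.ne'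
  have hM := isSymm_mul_inv hA h₂
  have hkey : cinner (B *ᵥ stdC l) (cvec x)
      + ∑ j, (starRingEnd ℂ) (A j l) * ((B * A⁻¹) *ᵥ cvec x) j = 2 * (A⁻¹ l ⬝ᵥ cvec x) := by
    have := congrFun (congrArg (fun N => N *ᵥ cvec x) (conjTranspose_add_mul_inv hA h₁)) l
    rw [add_mulVec, ← mulVec_mulVec, smul_mulVec] at this
    simpa only [cinner, mulVec_stdC] using! this
  have hgrad (j : Fin d) : grad (fun x => eval (cvec x) p * phi0 A B h s x) x j
      = (eval (cvec x) (pderiv j p) - eval (cvec x) p * ((h : ℂ)⁻¹ * ((B * A⁻¹) *ᵥ cvec x) j))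
        * phi0 A B h s x := by
    simp only [phi0_eq]
    rw [grad_eval_mul_exp_eval]
    simp only [map_add, map_mul, pderiv_C_mul, eval_C, eval_pderiv_quadForm hM]
    push_cast
    field_simp
    ring
  have hsum : (h : ℂ) * cinner (A *ᵥ stdC l)
        (grad (fun x => eval (cvec x) p * phi0 A B h s x) x)
      = (h * ∑ j, (starRingEnd ℂ) (A j l) * eval (cvec x) (pderiv j p)
        - eval (cvec x) p * ∑ j, (starRingEnd ℂ) (A j l) * ((B * A⁻¹) *ᵥ cvec x) j)
          * phi0 A B h s x := by
    simp only [cinner, hgrad, mulVec_stdC, Finset.mul_sum, ← Finset.sum_sub_distrib, Finset.sum_mul]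
    refine Finset.sum_congr rfl fun j _ => ?_
    field_simp
  have hD : eval (cvec x) (raiseDeriv A h l p) = ((√(2 * h) : ℝ) : ℂ)⁻¹ *
      (h * ∑ j, (starRingEnd ℂ) (A j l) * eval (cvec x) (pderiv j p)) := by
    simp only [raiseDeriv, dirDeriv_apply, map_sum, smul_eval, Pi.smul_apply, smul_eq_mul,
      Finset.mul_sum, mul_assoc]
  simp only [raiseOp, hsum, derivRaise, map_sub, map_mul, hD, raiseMul, eval_linForm,
    smul_dotProduct, smul_eq_mul]
  linear_combination ((√(2 * h) : ℝ) : ℂ)⁻¹ * eval (cvec x) p * phi0 A B h s x * hkey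

theorem phi0_ne_zero (hh : 0 < h) {s : ℂ} (hs : s ≠ 0) (x : Fin d → ℝ) : phi0 A B h s x ≠ 0 := by
  have : (Real.pi ^ (-(d : ℝ) / 4) * h ^ (-(d : ℝ) / 4) : ℝ) ≠ 0 := by positivity
  exact mul_ne_zero (mul_ne_zero (ofReal_ne_zero.2 this) (inv_ne_zero hs)) (exp_ne_zero _)

theorem Ppoly_eq_eval (hh : 0 < h) (hA : IsUnit A.det)
    (h₁ : Aᴴ * B + Bᴴ * A = (2 : ℂ) • (1 : Matrix (Fin d) (Fin d) ℂ)) (h₂ : Aᵀ * B - Bᵀ * A = 0)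
    {s : ℂ} (hs : s ≠ 0) (k : Fin d → ℕ) (x : Fin d → ℝ) :
    Ppoly A B h s k x = ((√2 : ℝ) : ℂ) ^ (∑ l, k l) *
      eval (cvec x) (opPow (derivRaise (raiseDeriv A h) (raiseMul A h)) k 1) := by
  have hsemi := opPow_semiconj (Φ := fun p x => eval (cvec x) p * phi0 A B h s x)
    (R := raiseOp A B h) (T := derivRaise (raiseDeriv A h) (raiseMul A h))
    (fun l p => (raiseOp_eval_mul_phi0 hh hA h₁ h₂ s l p).symm) k 1
  have h1 : (fun x => eval (cvec x) 1 * phi0 A B h s x) = phi0 A B h s := by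
    funext x; simp
  have hsemi' := congrFun hsemi x
  simp only [h1] at hsemi'
  rw [Ppoly, ← hsemi', mul_div_assoc, mul_div_cancel_right₀ _ (phi0_ne_zero hh hs x), Real.sqrt_eq_rpow,
    ← ofReal_pow, ← Real.rpow_natCast, ← Real.rpow_mul zero_le_two]
  congr 4
  ring

theorem Ppoly_recurrence (hh : 0 < h) (hA : IsUnit A.det)
    (h₁ : Aᴴ * B + Bᴴ * A = (2 : ℂ) • (1 : Matrix (Fin d) (Fin d) ℂ)) (h₂ : Aᵀ * B - Bᵀ * A = 0)
    {s : ℂ} (hs : s ≠ 0) (x : Fin d → ℝ) (k : Fin d → ℕ) (l : Fin d) :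
    Ppoly A B h s (k + Pi.single l 1) x
      = recurrenceRHS ((2 / ((√h : ℝ) : ℂ)) • A⁻¹ *ᵥ cvec x) (-(A⁻¹ * A.map (starRingEnd ℂ)))
          (fun k => Ppoly A B h s k x) l k := by
  have hS := isSymm_inv_mul_conj hA h₁ h₂
  have h2 : ((√2 : ℝ) : ℂ) ^ 2 = 2 := by simpa using ofReal_sqrt_sq zero_le_two
  have hmul : ((√2 : ℝ) : ℂ) * eval (cvec x) (raiseMul A h l)
      = ((2 / ((√h : ℝ) : ℂ)) • A⁻¹ *ᵥ cvec x) l := by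
    rw [raiseMul, eval_linForm, smul_dotProduct, Real.sqrt_mul zero_le_two, ofReal_mul]
    simp only [smul_eq_mul, Pi.smul_apply, mulVec]
    field_simp
  simp only [Ppoly_eq_eval hh hA h₁ h₂ hs]
  rw [opPow_derivRaise_one_add_single (D := raiseDeriv A h) (fun l m p => dirDeriv_comm _ _ p)
    (raiseDeriv_raiseMul hh hS) (fun l m => hS.apply m l), sum_add_single, recurrenceRHS, ← hmul]
  simp only [map_sub, map_mul, map_sum, smul_eval, mul_sub, Finset.mul_sum]
  rw [sub_eq_add_neg, ← Finset.sum_neg_distrib]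
  congr 1
  · ring
  · refine Finset.sum_congr rfl fun m _ => ?_
    by_cases hm : k m = 0
    · simp [hm]
    · have hk : ∑ i, k i = ∑ i, (k - Pi.single m 1 : Fin d → ℕ) i + 1 := by
        rw [← sum_add_single, sub_single_add_single hm]
      rw [hk, pow_succ, pow_succ, Matrix.neg_apply]
      generalize ((√2 : ℝ) : ℂ) ^ ∑ i, (k - Pi.single m 1 : Fin d → ℕ) i = c
      generalize eval (cvec x) (opPow _ _ _) = e
      linear_combination (-c * (A⁻¹ * A.map (starRingEnd ℂ)) l m * k m * e) * h2

end hagedorn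

/-- Theorem 3.1 (generating function): for every `x ∈ ℝ^d`, `z ∈ ℂ^d`, the series
`∑ₖ P_k(A,ℏ,x) zᵏ/k!` converges absolutely to
`exp(−⟨conj z, A⁻¹ conj(A) z⟩ + (2/√ℏ) ⟨conj z, A⁻¹ x⟩)`. -/
theorem generating_function
    {d : ℕ} (hd : 1 ≤ d) {hbar : ℝ} (hhbar : 0 < hbar)
    (A B : Matrix (Fin d) (Fin d) ℂ) (hA : IsUnit A.det) (hB : IsUnit B.det)
    (hAB₁ : Aᴴ * B + Bᴴ * A = (2 : ℂ) • (1 : Matrix (Fin d) (Fin d) ℂ))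
    (hAB₂ : Aᵀ * B - Bᵀ * A = 0)
    (sqrtA : ℂ) (hsqrtA : sqrtA ^ 2 = A.det)
    (x : Fin d → ℝ) (z : Fin d → ℂ) :
    Summable (fun k : Fin d → ℕ =>
      ‖Ppoly A B hbar sqrtA k x * (∏ l, z l ^ k l) / ((∏ l, Nat.factorial (k l) : ℕ) : ℂ)‖) ∧
    HasSum (fun k : Fin d → ℕ =>
        Ppoly A B hbar sqrtA k x * (∏ l, z l ^ k l) / ((∏ l, Nat.factorial (k l) : ℕ) : ℂ))
      (Complex.exp
        (-(cinner (fun j => (starRingEnd ℂ) (z j)) ((A⁻¹ * A.map (starRingEnd ℂ)).mulVec z))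
          + (2 / ((Real.sqrt hbar : ℝ) : ℂ)) *
              cinner (fun j => (starRingEnd ℂ) (z j)) (A⁻¹.mulVec (cvec x)))) := by
  have hs : sqrtA ≠ 0 := by
    rintro rfl
    exact hA.ne_zero (by rw [← hsqrtA]; simp)
  have hrec := Ppoly_recurrence hhbar hA hAB₁ hAB₂ hs x
  have h0 : Ppoly A B hbar sqrtA 0 x = 1 := by
    rw [Ppoly_eq_eval hhbar hA hAB₁ hAB₂ hs]
    simp [opPow_zero]
  convert norm_summable_and_hasSum_of_recurrence _ _ z (fun k => Ppoly A B hbar sqrtA k x) h0 hrec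
    using 3
  rw [add_comm]
  congr 1
  · simp only [cinner, conj_conj, Pi.smul_apply, smul_eq_mul, Finset.mul_sum]
    exact Finset.sum_congr rfl fun l _ => by ring
  · simp only [cinner, conj_conj, mulVec, dotProduct, Finset.mul_sum, ← Finset.sum_neg_distrib,
      Matrix.neg_apply]
    exact Finset.sum_congr rfl fun l _ => Finset.sum_congr rfl fun m _ => by ring

end
end

section
/- The matrix A A* has real entries and is symmetric positive definite; consequently its unique positive definite square root |A| = (A A*)^{1/2} is a real symmetric positive definite matrix. -/
open Matrix Complex
open scoped ComplexOrder

noncomputable section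

open scoped MatrixOrder in
/-- A positive definite complex matrix has a unique positive definite square root. -/
theorem Matrix.PosDef.existsUnique_posDef_mul_self {n : Type*} [Fintype n] [DecidableEq n]
    {P : Matrix n n ℂ} (hP : P.PosDef) :
    ∃! S : Matrix n n ℂ, S.PosDef ∧ S * S = P := by
  have hsq : CFC.sqrt P * CFC.sqrt P = P := CFC.sqrt_mul_sqrt_self P hP.posSemidef.nonneg
  have hu : IsUnit (CFC.sqrt P) := (CFC.isUnit_sqrt_iff P hP.posSemidef.nonneg).mpr hP.isUnit
  refine ⟨CFC.sqrt P,
    ⟨(CFC.sqrt_nonneg P).posSemidef.posDef_iff_isUnit.mpr hu, hsq⟩, ?_⟩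
  rintro S ⟨hS, hSP⟩
  exact (CFC.sqrt_unique hSP hS.posSemidef.nonneg).symm

/-- A Hermitian complex matrix that is symmetric has real entries. -/
theorem Matrix.IsHermitian.im_apply_eq_zero {n : Type*} {S : Matrix n n ℂ}
    (hS : S.IsHermitian) (hT : Sᵀ = S) (i j : n) : (S i j).im = 0 := by
  have h : star (S i j) = S i j := by
    rw [hS.apply j i, ← Matrix.transpose_apply S, hT]
  exact Complex.conj_eq_iff_im.mp h

/-- The relations between `A` and `B` force `A * Aᴴ` to be symmetric: `B * A⁻¹` is symmetric and
the sum of it and its conjugate transpose is `2 • (A * Aᴴ)⁻¹`. -/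
theorem Matrix.transpose_mul_conjTranspose_self_of_relations {n : Type*} [Fintype n]
    [DecidableEq n] {A B : Matrix n n ℂ} (hA : IsUnit A.det)
    (h₁ : Aᴴ * B + Bᴴ * A = (2 : ℂ) • (1 : Matrix n n ℂ)) (h₂ : Aᵀ * B - Bᵀ * A = 0) :
    (A * Aᴴ)ᵀ = A * Aᴴ := by
  have hAi : A * A⁻¹ = 1 := Matrix.mul_nonsing_inv A hA
  have hH : (A⁻¹)ᴴ * Aᴴ = 1 := by
    rw [← Matrix.conjTranspose_mul, hAi, Matrix.conjTranspose_one]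
  have hT : (A⁻¹)ᵀ * Aᵀ = 1 := by
    rw [← Matrix.transpose_mul, hAi, Matrix.transpose_one]
  have hM : (B * A⁻¹)ᵀ = B * A⁻¹ := by
    calc (B * A⁻¹)ᵀ = (A⁻¹)ᵀ * (Bᵀ * A) * A⁻¹ := by
          simp only [Matrix.transpose_mul, Matrix.mul_assoc, hAi, Matrix.mul_one]
      _ = (A⁻¹)ᵀ * Aᵀ * (B * A⁻¹) := by
          rw [← sub_eq_zero.mp h₂]; simp only [Matrix.mul_assoc]
      _ = B * A⁻¹ := by rw [hT, Matrix.one_mul]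
  have hsum : B * A⁻¹ + (B * A⁻¹)ᴴ = (2 : ℂ) • (A * Aᴴ)⁻¹ := by
    calc B * A⁻¹ + (B * A⁻¹)ᴴ
        = (A⁻¹)ᴴ * Aᴴ * (B * A⁻¹) + (A⁻¹)ᴴ * Bᴴ * (A * A⁻¹) := by
          rw [hH, hAi, Matrix.one_mul, Matrix.mul_one, Matrix.conjTranspose_mul]
      _ = (A⁻¹)ᴴ * (Aᴴ * B + Bᴴ * A) * A⁻¹ := by
          simp only [Matrix.mul_add, Matrix.add_mul, Matrix.mul_assoc]
      _ = (2 : ℂ) • (A * Aᴴ)⁻¹ := by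
          rw [h₁, Matrix.mul_inv_rev, Matrix.conjTranspose_nonsing_inv, Matrix.mul_smul,
            Matrix.mul_one, Matrix.smul_mul]
  have hinv : ((A * Aᴴ)⁻¹)ᵀ = (A * Aᴴ)⁻¹ := by
    refine smul_right_injective _ (two_ne_zero (α := ℂ)) ?_
    have hMH : ((B * A⁻¹)ᴴ)ᵀ = (B * A⁻¹)ᴴ := by
      conv_rhs => rw [← hM]
      rfl
    change (2 : ℂ) • ((A * Aᴴ)⁻¹)ᵀ = (2 : ℂ) • (A * Aᴴ)⁻¹
    rw [← Matrix.transpose_smul, ← hsum, Matrix.transpose_add, hM, hMH]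
  have hdet : IsUnit (A * Aᴴ).det := by
    rw [Matrix.det_mul, Matrix.det_conjTranspose]
    exact hA.mul hA.star
  rw [← Matrix.nonsing_inv_nonsing_inv (A * Aᴴ) hdet, Matrix.transpose_nonsing_inv, hinv]

/-- `A A*` has real entries and is symmetric positive definite; consequently it has a
unique positive definite square root `|A|`, and any such square root is real and
symmetric. -/
theorem AAstar_real_symmetric_posDef_sqrt
    {d : ℕ} (hd : 1 ≤ d)
    (A B : Matrix (Fin d) (Fin d) ℂ) (hA : IsUnit A.det) (hB : IsUnit B.det)
    (hAB₁ : Aᴴ * B + Bᴴ * A = (2 : ℂ) • (1 : Matrix (Fin d) (Fin d) ℂ))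
    (hAB₂ : Aᵀ * B - Bᵀ * A = 0) :
    (∀ i j, ((A * Aᴴ) i j).im = 0) ∧
    (A * Aᴴ)ᵀ = A * Aᴴ ∧
    (A * Aᴴ).PosDef ∧
    (∃! S : Matrix (Fin d) (Fin d) ℂ, S.PosDef ∧ S * S = A * Aᴴ) ∧
    (∀ S : Matrix (Fin d) (Fin d) ℂ, S.PosDef → S * S = A * Aᴴ →
      (∀ i j, (S i j).im = 0) ∧ Sᵀ = S) := by
  have hT := Matrix.transpose_mul_conjTranspose_self_of_relations hA hAB₁ hAB₂
  have hP : (A * Aᴴ).PosDef :=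
    (Matrix.posSemidef_self_mul_conjTranspose A).posDef_iff_isUnit.mpr <| by
      rw [Matrix.isUnit_iff_isUnit_det, Matrix.det_mul, Matrix.det_conjTranspose]
      exact hA.mul hA.star
  have hex := hP.existsUnique_posDef_mul_self
  refine ⟨hP.isHermitian.im_apply_eq_zero hT, hT, hP, hex, fun S hS hSP => ?_⟩
  have hST : Sᵀ = S :=
    hex.unique ⟨hS.transpose, by rw [← Matrix.transpose_mul, hSP, hT]⟩ ⟨hS, hSP⟩
  exact ⟨hS.isHermitian.im_apply_eq_zero hST, hST⟩

end
end

section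
/- For every multi-index k ∈ ℕ^d and every x ∈ ℝ^d, P_k(A,ℏ,x) = P_k(A,1,x/√ℏ); i.e. the polynomial P_k at semiclassical parameter ℏ is obtained from the one at ℏ = 1 by the scaling x ↦ x/√ℏ. -/
open Matrix Complex

noncomputable section

/-- The rescaling `ψ ↦ c * ψ (s • ·)` of functions on `ℝ^d`. -/
def dilation {d : ℕ} (s : ℝ) (c : ℂ) (ψ : (Fin d → ℝ) → ℂ) : (Fin d → ℝ) → ℂ :=
  fun x => c * ψ (s • x)

theorem cinner_smul_right {d : ℕ} (a b : Fin d → ℂ) (c : ℂ) :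
    cinner a (c • b) = c * cinner a b := by
  simp only [cinner, Pi.smul_apply, smul_eq_mul, Finset.mul_sum]
  exact Finset.sum_congr rfl fun j _ => by ring

theorem cinner_ofReal_smul_left {d : ℕ} (a b : Fin d → ℂ) (s : ℝ) :
    cinner ((s : ℂ) • a) b = s * cinner a b := by
  simp only [cinner, Pi.smul_apply, smul_eq_mul, Finset.mul_sum, map_mul, Complex.conj_ofReal,
    mul_assoc]

theorem cvec_smul {d : ℕ} (s : ℝ) (x : Fin d → ℝ) : cvec (s • x) = (s : ℂ) • cvec x := by
  ext j
  simp [cvec]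

theorem grad_dilation {d : ℕ} (s : ℝ) (c : ℂ) (ψ : (Fin d → ℝ) → ℂ) (x : Fin d → ℝ) :
    grad (dilation s c ψ) x = (c * s) • grad ψ (s • x) := by
  have h : fderiv ℝ (dilation s c ψ) x = c • s • fderiv ℝ ψ (s • x) := by
    rw [← fderiv_comp_smul]
    exact congrFun (fderiv_const_smul_field (𝕜 := ℝ) (f := fun y => ψ (s • y)) c) x
  ext j
  simp [grad, h, mul_assoc]

theorem semiconj_dilation_raiseOp {d : ℕ} (A B : Matrix (Fin d) (Fin d) ℂ) {h : ℝ} (hh : 0 < h)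
    (c : ℂ) (l : Fin d) :
    Function.Semiconj (dilation (√h) c) (raiseOp A B h l) (raiseOp A B 1 l) := by
  intro ψ
  ext x
  have hs : ((√h : ℝ) : ℂ) ≠ 0 := by exact_mod_cast (Real.sqrt_pos.2 hh).ne'
  have hsq : (h : ℂ) = (√h : ℝ) * (√h : ℝ) := by exact_mod_cast (Real.mul_self_sqrt hh.le).symm
  simp only [raiseOp, grad_dilation, cinner_smul_right]
  simp only [dilation, cvec_smul, raiseOp, cinner_smul_right, mul_one, Complex.ofReal_one,
    Real.sqrt_mul zero_le_two, Complex.ofReal_mul]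
  rw [hsq]
  field_simp

theorem semiconj_opPow {d : ℕ} {α : Type*} {T : α → α} {R S : Fin d → α → α}
    (h : ∀ l, Function.Semiconj T (R l) (S l)) (k : Fin d → ℕ) :
    Function.Semiconj T (opPow R k) (opPow S k) := by
  unfold opPow
  induction List.finRange d with
  | nil => exact Function.Semiconj.id_right
  | cons l L ih => exact ((h l).iterate_right (k l)).comp_right ih

theorem dilation_phi0 {d : ℕ} (A B : Matrix (Fin d) (Fin d) ℂ) {h : ℝ} (hh : 0 < h)
    (sqrtA : ℂ) :
    dilation (√h) ((h ^ (-(d : ℝ) / 4) : ℝ) : ℂ)⁻¹ (phi0 A B h sqrtA) = phi0 A B 1 sqrtA := by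
  ext x
  have hc : ((h ^ (-(d : ℝ) / 4) : ℝ) : ℂ) ≠ 0 := by
    exact_mod_cast (Real.rpow_pos_of_pos hh _).ne'
  have hs : ((√h : ℝ) : ℂ) ≠ 0 := by exact_mod_cast (Real.sqrt_pos.2 hh).ne'
  have hsq : (h : ℂ) = (√h : ℝ) * (√h : ℝ) := by exact_mod_cast (Real.mul_self_sqrt hh.le).symm
  have hexp (z : ℂ) :
      (√h : ℝ) * ((√h : ℝ) * z) / ((2 * h : ℝ) : ℂ) = z / ((2 * 1 : ℝ) : ℂ) := by
    push_cast
    rw [hsq]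
    field_simp
  simp only [dilation, phi0, cvec_smul, Matrix.mulVec_smul, cinner_smul_right,
    cinner_ofReal_smul_left, hexp]
  rw [Real.one_rpow, mul_one (Real.pi ^ (-(d : ℝ) / 4)), Complex.ofReal_mul,
    mul_comm ((Real.pi ^ (-(d : ℝ) / 4) : ℝ) : ℂ),
    mul_assoc, mul_assoc, inv_mul_cancel_left₀ hc, ← mul_assoc]

/-- Scaling in `ℏ`: `P_k(A,ℏ,x) = P_k(A,1,x/√ℏ)`. -/
theorem Ppoly_scaling
    {d : ℕ} (hd : 1 ≤ d) {hbar : ℝ} (hhbar : 0 < hbar)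
    (A B : Matrix (Fin d) (Fin d) ℂ) (hA : IsUnit A.det) (hB : IsUnit B.det)
    (hAB₁ : Aᴴ * B + Bᴴ * A = (2 : ℂ) • (1 : Matrix (Fin d) (Fin d) ℂ))
    (hAB₂ : Aᵀ * B - Bᵀ * A = 0)
    (sqrtA : ℂ) (hsqrtA : sqrtA ^ 2 = A.det)
    (k : Fin d → ℕ) (x : Fin d → ℝ) :
    Ppoly A B hbar sqrtA k x =
      Ppoly A B 1 sqrtA k (fun j => x j / Real.sqrt hbar) := by
  set c : ℂ := ((hbar ^ (-(d : ℝ) / 4) : ℝ) : ℂ)⁻¹ with hc_def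
  have hc : c ≠ 0 := inv_ne_zero (by exact_mod_cast (Real.rpow_pos_of_pos hhbar _).ne')
  have hx : √hbar • (fun j => x j / √hbar) = x := by
    ext j
    simp [mul_div_cancel₀ _ (Real.sqrt_pos.2 hhbar).ne']
  have hpow := semiconj_opPow (semiconj_dilation_raiseOp A B hhbar c) k (phi0 A B hbar sqrtA)
  rw [dilation_phi0 A B hhbar] at hpow
  simp only [Ppoly]
  rw [← hpow, ← dilation_phi0 A B hhbar]
  simp only [dilation, hx, ← hc_def]
  rw [mul_left_comm, mul_div_mul_left _ _ hc]

end
end
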